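/- Mellin–Barnes representation of the Whittaker function: let y > 0 and μ, ν ∈ ℂ satisfy Re ν > 0, Re μ + Re ν < 1/2, and μ + ν + 1/2 not a nonpositive integer. Then for every real c with 0 < c < 1/2 − Re μ − Re ν one has W_{μ,ν}(y) = (y^μ e^{−y/2} / (2π)) · ∫_{−∞}^{∞} [Γ(−c+it−μ+ν+1/2) · Γ(−c+it−μ−ν+1/2) · Γ(c−it) / (Γ(1/2−μ+ν) · Γ(1/2−μ−ν))] · y^{c−it} dt, where y^μ and y^{c−it} are defined via the real logarithm of y; the integral converges absolutely. -/

import Mathlib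

open MeasureTheory

/-- The Whittaker function W_{μ,ν}(y), defined for Re ν > 0, μ + ν + 1/2 not a nonpositive
integer and y > 0 by the absolutely convergent integral
W_{μ,ν}(y) = e^{iπμ} Γ(μ+ν+1/2) π^{−1} (y/4)^{1/2−ν}
  ∫ e^{−iyξ/2} (ξ²+1)^{−ν−1/2} exp(μ(Log(ξ−i) − Log(ξ+i))) dξ. -/
noncomputable def Wh (μ ν : ℂ) (y : ℝ) : ℂ :=
  Complex.exp (Complex.I * (Real.pi : ℂ) * μ) * Complex.Gamma (μ + ν + 1 / 2) / (Real.pi : ℂ) *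
    ((y / 4 : ℝ) : ℂ) ^ ((1 : ℂ) / 2 - ν) *
    ∫ ξ : ℝ,
      Complex.exp (-Complex.I * (y : ℂ) * (ξ : ℂ) / 2) *
        ((ξ ^ 2 + 1 : ℝ) : ℂ) ^ (-ν - 1 / 2) *
        Complex.exp (μ * (Complex.log ((ξ : ℂ) - Complex.I) - Complex.log ((ξ : ℂ) + Complex.I)))

/-- Holomorphy of an exponential-type parametric integral wherever it converges absolutely. -/
theorem differentiableOn_integral_exp_mul {α : Type*} [MeasurableSpace α] {m : Measure α}
    {U : Set ℂ} (hU : IsOpen U) {l g : α → ℂ} (hl : AEStronglyMeasurable l m)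
    (hg : AEStronglyMeasurable g m)
    (hint : ∀ z ∈ U, Integrable (fun a => Complex.exp (z * l a) * g a) m) :
    DifferentiableOn ℂ (fun z => ∫ a, Complex.exp (z * l a) * g a ∂m) U := by
  intro z₀ hz₀
  obtain ⟨ε, hε, hball⟩ := Metric.isOpen_iff.1 hU z₀ hz₀
  set δ : ℝ := ε / 4 with hδ
  have hδ0 : 0 < δ := by positivity
  have hmem : ∀ s t : ℝ, |s| = 1 → |t| = 1 →
      z₀ + (2 * δ) * (s + t * Complex.I) ∈ U := by
    intro s t hs ht
    have h1 : ‖((s : ℂ) + t * Complex.I)‖ ≤ √2 := by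
      rw [Complex.norm_add_mul_I, ← sq_abs s, ← sq_abs t, hs, ht]
      norm_num
    have h2 : √2 < 2 := by
      rw [Real.sqrt_lt' (by norm_num)]; norm_num
    apply hball
    rw [mem_ball_iff_norm, add_sub_cancel_left, norm_mul, norm_mul, Complex.norm_real,
      Complex.norm_ofNat, Real.norm_of_nonneg hδ0.le]
    nlinarith [norm_nonneg ((s : ℂ) + t * Complex.I)]
  have key : ∀ w : ℂ, Real.exp (2 * δ * ‖w‖) ≤
      ‖Complex.exp ((2 * δ) * ((1:ℝ) + (1:ℝ) * Complex.I) * w)‖ +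
      ‖Complex.exp ((2 * δ) * ((1:ℝ) + (-1:ℝ) * Complex.I) * w)‖ +
      ‖Complex.exp ((2 * δ) * ((-1:ℝ) + (1:ℝ) * Complex.I) * w)‖ +
      ‖Complex.exp ((2 * δ) * ((-1:ℝ) + (-1:ℝ) * Complex.I) * w)‖ := by
    intro w
    have h := Complex.norm_le_abs_re_add_abs_im w
    simp only [Complex.norm_exp]
    have hre : ∀ s t : ℝ, ((2 * (δ : ℂ)) * ((s : ℂ) + (t : ℂ) * Complex.I) * w).re
        = 2 * δ * (s * w.re - t * w.im) := by
      intro s t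
      simp [Complex.mul_re]
      ring
    simp only [hre]
    have hp : ∀ x : ℝ, 0 < Real.exp x := Real.exp_pos
    have hmono : ∀ x : ℝ, |w.re| + |w.im| = x →
        Real.exp (2 * δ * ‖w‖) ≤ Real.exp (2 * δ * x) := by
      rintro x rfl
      apply Real.exp_le_exp.2
      gcongr
    rcases abs_cases w.re with ⟨h1, -⟩ | ⟨h1, -⟩ <;> rcases abs_cases w.im with ⟨h2, -⟩ | ⟨h2, -⟩
    · have := hmono (1 * w.re - (-1) * w.im) (by rw [h1, h2]; ring)
      linarith [hp (2 * δ * (1 * w.re - 1 * w.im)), hp (2 * δ * (-1 * w.re - 1 * w.im)),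
        hp (2 * δ * (-1 * w.re - (-1) * w.im))]
    · have := hmono (1 * w.re - 1 * w.im) (by rw [h1, h2]; ring)
      linarith [hp (2 * δ * (1 * w.re - (-1) * w.im)), hp (2 * δ * (-1 * w.re - 1 * w.im)),
        hp (2 * δ * (-1 * w.re - (-1) * w.im))]
    · have := hmono (-1 * w.re - (-1) * w.im) (by rw [h1, h2]; ring)
      linarith [hp (2 * δ * (1 * w.re - (-1) * w.im)), hp (2 * δ * (-1 * w.re - 1 * w.im)),
        hp (2 * δ * (1 * w.re - 1 * w.im))]
    · have := hmono (-1 * w.re - 1 * w.im) (by rw [h1, h2]; ring)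
      linarith [hp (2 * δ * (1 * w.re - (-1) * w.im)), hp (2 * δ * (-1 * w.re - (-1) * w.im)),
        hp (2 * δ * (1 * w.re - 1 * w.im))]
  have hnear : ∀ᶠ z in nhds z₀, AEStronglyMeasurable (fun a => Complex.exp (z * l a) * g a) m := by
    filter_upwards [hU.mem_nhds hz₀] with z hz using (hint z hz).aestronglyMeasurable
  have hF' : AEStronglyMeasurable (fun a => l a * Complex.exp (z₀ * l a) * g a) m :=
    (hl.mul (Complex.continuous_exp.comp_aestronglyMeasurable (hl.const_mul z₀))).mul hg
  let bound : α → ℝ := fun a =>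
    δ⁻¹ * (‖Complex.exp ((z₀ + (2 * δ) * ((1:ℝ) + (1:ℝ) * Complex.I)) * l a) * g a‖ +
      ‖Complex.exp ((z₀ + (2 * δ) * ((1:ℝ) + (-1:ℝ) * Complex.I)) * l a) * g a‖ +
      ‖Complex.exp ((z₀ + (2 * δ) * ((-1:ℝ) + (1:ℝ) * Complex.I)) * l a) * g a‖ +
      ‖Complex.exp ((z₀ + (2 * δ) * ((-1:ℝ) + (-1:ℝ) * Complex.I)) * l a) * g a‖)
  have hbi : Integrable bound m := by
    refine Integrable.const_mul ?_ _
    refine (((hint _ (hmem 1 1 (by simp) (by simp))).norm.add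
      (hint _ (hmem 1 (-1) (by simp) (by simp))).norm).add
      (hint _ (hmem (-1) 1 (by simp) (by simp))).norm).add
      (hint _ (hmem (-1) (-1) (by simp) (by simp))).norm
  have := hasDerivAt_integral_of_dominated_loc_of_deriv_le
    (F := fun z a => Complex.exp (z * l a) * g a)
    (F' := fun z a => l a * Complex.exp (z * l a) * g a) (bound := bound)
    (Metric.ball_mem_nhds z₀ hδ0) hnear (hint z₀ hz₀) hF' ?_ hbi ?_
  · exact this.2.differentiableAt.differentiableWithinAt
  · refine Filter.Eventually.of_forall fun a z hz => ?_
    have hz' : ‖z - z₀‖ ≤ δ := (mem_ball_iff_norm.1 hz).le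
    have e1 : ‖Complex.exp (z * l a)‖ ≤ ‖Complex.exp (z₀ * l a)‖ * Real.exp (δ * ‖l a‖) := by
      rw [Complex.norm_exp, Complex.norm_exp, ← Real.exp_add]
      apply Real.exp_le_exp.2
      have h1 := Complex.re_le_norm ((z - z₀) * l a)
      rw [norm_mul, sub_mul, Complex.sub_re] at h1
      have h2 := mul_le_mul_of_nonneg_right hz' (norm_nonneg (l a))
      linarith
    have e2 : ‖l a‖ ≤ δ⁻¹ * Real.exp (δ * ‖l a‖) := by
      rw [inv_mul_eq_div, le_div_iff₀ hδ0]
      linarith [Real.add_one_le_exp (δ * ‖l a‖)]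
    have e3 : ‖l a * Complex.exp (z * l a) * g a‖ ≤
        δ⁻¹ * (‖Complex.exp (z₀ * l a)‖ * Real.exp (2 * δ * ‖l a‖) * ‖g a‖) := by
      rw [norm_mul, norm_mul]
      calc _ ≤ (δ⁻¹ * Real.exp (δ * ‖l a‖)) *
            (‖Complex.exp (z₀ * l a)‖ * Real.exp (δ * ‖l a‖)) * ‖g a‖ := by gcongr
        _ = _ := by
          rw [show 2 * δ * ‖l a‖ = δ * ‖l a‖ + δ * ‖l a‖ by ring, Real.exp_add]; ring
    refine e3.trans ?_
    simp only [bound, add_mul z₀, Complex.exp_add, norm_mul]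
    have := mul_le_mul_of_nonneg_left (mul_le_mul_of_nonneg_right (key (l a)) (norm_nonneg (g a)))
      (norm_nonneg (Complex.exp (z₀ * l a)))
    gcongr
    linarith
  · refine Filter.Eventually.of_forall fun a z hz => ?_
    have := ((((hasDerivAt_id z).mul_const (l a)).cexp).mul_const (g a))
    simpa [mul_comm] using this

theorem integrableOn_cpow_mul_cexp_neg_mul {s r : ℂ} (hs : 0 < s.re) (hr : 0 < r.re) :
    IntegrableOn (fun t : ℝ => (t : ℂ) ^ (s - 1) * Complex.exp (-(r * t))) (Set.Ioi 0) := by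
  have h := integrableOn_rpow_mul_exp_neg_mul_rpow (p := 1) (s := s.re - 1) (b := r.re)
    (by linarith) (by norm_num) hr
  refine Integrable.mono' h ?_ ?_
  · apply ContinuousOn.aestronglyMeasurable _ measurableSet_Ioi
    intro t ht
    refine ContinuousAt.continuousWithinAt (ContinuousAt.mul ?_ (by fun_prop))
    exact Complex.continuousAt_ofReal_cpow_const _ _ (Or.inr ht.ne')
  · refine (ae_restrict_iff' measurableSet_Ioi).2 (Filter.Eventually.of_forall fun t ht => ?_)
    rw [norm_mul, Complex.norm_cpow_eq_rpow_re_of_pos ht, Complex.norm_exp]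
    simp

theorem integral_cpow_mul_cexp_neg_mul_Ioi {s r : ℂ} (hs : 0 < s.re) (hr : 0 < r.re) :
    ∫ t : ℝ in Set.Ioi 0, (t : ℂ) ^ (s - 1) * Complex.exp (-(r * t)) =
      r ^ (-s) * Complex.Gamma s := by
  have hU : IsOpen {z : ℂ | 0 < z.re} := isOpen_lt continuous_const Complex.continuous_re
  have hconv : Convex ℝ {z : ℂ | 0 < z.re} := convex_halfSpace_re_gt 0
  have hL : DifferentiableOn ℂ (fun z : ℂ => ∫ t : ℝ in Set.Ioi 0,
      Complex.exp (z * (-t : ℂ)) * (t : ℂ) ^ (s - 1)) {z : ℂ | 0 < z.re} := by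
    refine differentiableOn_integral_exp_mul hU (by fun_prop) ?_ ?_
    · apply ContinuousOn.aestronglyMeasurable _ measurableSet_Ioi
      intro t ht
      exact (Complex.continuousAt_ofReal_cpow_const _ _ (Or.inr ht.ne')).continuousWithinAt
    · intro z hz
      refine (integrableOn_cpow_mul_cexp_neg_mul hs hz).congr
        (Filter.Eventually.of_forall fun t => ?_)
      simp only [mul_neg, mul_comm]
  have hR : DifferentiableOn ℂ (fun z : ℂ => z ^ (-s) * Complex.Gamma s) {z : ℂ | 0 < z.re} := by
    intro z hz
    exact ((differentiableAt_id.cpow_const (Or.inl hz)).mul_const _).differentiableWithinAt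
  have := (hL.analyticOnNhd hU).eqOn_of_preconnected_of_frequently_eq (hR.analyticOnNhd hU)
    hconv.isPreconnected (z₀ := 1) (by simp) ?_ hr
  · simp only at this
    rw [← this]
    refine setIntegral_congr_fun measurableSet_Ioi fun t ht => ?_
    simp only [mul_neg, mul_comm]
  · have hfr : ∃ᶠ x : ℝ in nhdsWithin 1 {1}ᶜ, 0 < x :=
      ((eventually_gt_nhds zero_lt_one).filter_mono nhdsWithin_le_nhds).frequently
    have ht : Filter.Tendsto (fun x : ℝ => (x : ℂ)) (nhdsWithin 1 {1}ᶜ) (nhdsWithin 1 {1}ᶜ) := by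
      refine tendsto_nhdsWithin_of_tendsto_nhds_of_eventually_within _ ?_ ?_
      · exact (Complex.continuous_ofReal.tendsto' 1 1 (by simp)).mono_left nhdsWithin_le_nhds
      · filter_upwards [self_mem_nhdsWithin] with x hx
        simpa using hx
    refine ht.frequently (hfr.mono fun x hx => ?_)
    have := Complex.integral_cpow_mul_exp_neg_mul_Ioi hs hx
    rw [one_div, Complex.inv_cpow _ _ (by
      rw [Complex.arg_ofReal_of_nonneg hx.le]; exact Real.pi_pos.ne), ← Complex.cpow_neg] at this
    rw [← this]
    refine setIntegral_congr_fun measurableSet_Ioi fun t ht => ?_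
    simp only [mul_neg, mul_comm]

theorem norm_Gamma_le_Gamma_re {s : ℂ} (hs : 0 < s.re) : ‖Complex.Gamma s‖ ≤ Real.Gamma s.re := by
  rw [Complex.Gamma_eq_integral hs, Real.Gamma_eq_integral hs, Complex.GammaIntegral]
  refine (norm_integral_le_integral_norm _).trans (le_of_eq ?_)
  refine setIntegral_congr_fun measurableSet_Ioi fun t ht => ?_
  simp only [norm_mul, Complex.norm_real, Complex.norm_cpow_eq_rpow_re_of_pos ht, Real.norm_eq_abs,
    Real.abs_exp, Complex.sub_re, Complex.one_re]

theorem continuous_Gamma_vertical {c : ℝ} (hc : 0 < c) {f : ℝ → ℂ} (hf : Continuous f)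
    (hre : ∀ t, (f t).re = c) : Continuous fun t => Complex.Gamma (f t) := by
  refine continuous_iff_continuousAt.2 fun t => ?_
  refine ContinuousAt.comp (f := f) (g := Complex.Gamma) ?_ hf.continuousAt
  refine (Complex.differentiableAt_Gamma _ fun m h => ?_).continuousAt
  have := hre t
  rw [h] at this
  simp at this
  have : (0 : ℝ) ≤ m := by positivity
  linarith

/-- Both Gamma factors are bounded on vertical lines, and shifting the argument of the first by two
gains quadratic decay. -/
theorem integrable_Gamma_mul_Gamma {a : ℂ} {c : ℝ} (hc : 0 < c) (ha : c < a.re) :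
    Integrable fun t : ℝ => Complex.Gamma (c + t * Complex.I) *
      Complex.Gamma (a - (c + t * Complex.I)) := by
  have hcont : Continuous fun t : ℝ => Complex.Gamma (c + t * Complex.I) *
      Complex.Gamma (a - (c + t * Complex.I)) :=
    (continuous_Gamma_vertical hc (by fun_prop) (by simp)).mul
      (continuous_Gamma_vertical (sub_pos.2 ha) (by fun_prop) (by simp))
  refine Integrable.mono' (g := fun t => (Real.Gamma (c + 2) * Real.Gamma (a.re - c)) *
    (min (c ^ 2) 1)⁻¹ * (1 + t ^ 2)⁻¹) (integrable_inv_one_add_sq.const_mul _)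
    hcont.aestronglyMeasurable (Filter.Eventually.of_forall fun t => ?_)
  set w : ℂ := c + t * Complex.I with hw
  have hwre : w.re = c := by simp [hw]
  have hwim : w.im = t := by simp [hw]
  have hw0 : w ≠ 0 := fun h => by rw [h] at hwre; simp at hwre; linarith
  have hw1 : w + 1 ≠ 0 := fun h => by
    have := congrArg Complex.re h
    simp [hwre] at this; linarith
  have hrec : Complex.Gamma (w + 2) = (w + 1) * (w * Complex.Gamma w) := by
    rw [← Complex.Gamma_add_one _ hw0, ← Complex.Gamma_add_one _ hw1]; ring_nf
  have h1 : ‖w + 1‖ * ‖w‖ * ‖Complex.Gamma w‖ ≤ Real.Gamma (c + 2) := by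
    rw [mul_assoc, ← norm_mul, ← norm_mul, ← hrec]
    convert! norm_Gamma_le_Gamma_re (s := w + 2) ?_ using 2
    · simp [hwre]
    · simp [hwre]; linarith
  have h2 : ‖Complex.Gamma (a - w)‖ ≤ Real.Gamma (a.re - c) := by
    convert! norm_Gamma_le_Gamma_re (s := a - w) ?_ using 2
    · simp [hwre]
    · simp [hwre]; linarith
  have h3 : min (c ^ 2) 1 * (1 + t ^ 2) ≤ ‖w + 1‖ * ‖w‖ := by
    have hm : ‖w‖ ≤ ‖w + 1‖ := by
      rw [← abs_norm w, ← abs_norm (w + 1), ← sq_le_sq, Complex.sq_norm, Complex.sq_norm,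
        Complex.normSq_apply, Complex.normSq_apply]
      simp [hwre, hwim]; nlinarith
    have hs : ‖w‖ * ‖w‖ = c ^ 2 + t ^ 2 := by
      rw [← sq, Complex.sq_norm, Complex.normSq_apply, hwre, hwim]; ring
    have := mul_le_mul_of_nonneg_right hm (norm_nonneg w)
    have := min_le_left (c ^ 2) 1
    have := min_le_right (c ^ 2) 1
    nlinarith [sq_nonneg t]
  have hmin : 0 < min (c ^ 2) 1 := lt_min (by positivity) one_pos
  have h4 : ‖Complex.Gamma w‖ ≤ Real.Gamma (c + 2) * (min (c ^ 2) 1)⁻¹ * (1 + t ^ 2)⁻¹ := by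
    rw [mul_assoc, ← mul_inv, ← div_eq_mul_inv, le_div_iff₀ (by positivity)]
    refine le_trans ?_ h1
    rw [mul_comm]
    gcongr
  have hG : 0 ≤ Real.Gamma (a.re - c) := Real.Gamma_nonneg_of_nonneg (by linarith)
  rw [norm_mul]
  calc _ ≤ Real.Gamma (c + 2) * (min (c ^ 2) 1)⁻¹ * (1 + t ^ 2)⁻¹ * Real.Gamma (a.re - c) := by
        gcongr
    _ = _ := by ring

/-- Beta integral of the second kind, as a Mellin transform. -/
theorem hasMellin_one_add_cpow_neg {a w : ℂ} (hw : 0 < w.re) (ha : w.re < a.re) :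
    HasMellin (fun x : ℝ => (1 + x : ℂ) ^ (-a)) w
      (Complex.Gamma w * Complex.Gamma (a - w) / Complex.Gamma a) := by
  have ha0 : 0 < a.re := hw.trans ha
  have hΓ : Complex.Gamma a ≠ 0 := Complex.Gamma_ne_zero_of_re_pos ha0
  let f : ℝ → ℝ → ℂ := fun x t => (x : ℂ) ^ (w - 1) * ((t : ℂ) ^ (a - 1) *
    Complex.exp (-((1 + x) * t)))
  have hfact : ∀ x t, f x t = ((t : ℂ) ^ (a - 1) * Complex.exp (-t)) *
      ((x : ℂ) ^ (w - 1) * Complex.exp (-(t * x))) := fun x t => by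
    simp only [f]
    rw [show -((1 + (x : ℂ)) * t) = -t + -(t * x) by ring, Complex.exp_add]; ring
  have hx : ∀ x ∈ Set.Ioi (0 : ℝ), ∫ t : ℝ in Set.Ioi 0, f x t =
      (x : ℂ) ^ (w - 1) * ((1 + x : ℂ) ^ (-a) * Complex.Gamma a) := fun x hx => by
    simp only [f]
    rw [integral_const_mul, integral_cpow_mul_cexp_neg_mul_Ioi ha0]
    simp only [Set.mem_Ioi] at hx
    simp; linarith
  have ht : ∀ t ∈ Set.Ioi (0 : ℝ), ∫ x : ℝ in Set.Ioi 0, f x t =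
      Complex.Gamma w * ((t : ℂ) ^ (a - w - 1) * Complex.exp (-t)) := fun t ht => by
    simp only [hfact]
    rw [integral_const_mul, integral_cpow_mul_cexp_neg_mul_Ioi hw (by simpa using ht),
      show a - w - 1 = (a - 1) + (-w) by ring, Complex.cpow_add _ _ (by simpa using ht.ne')]
    ring
  have hint : Integrable (Function.uncurry f)
      ((volume.restrict (Set.Ioi 0)).prod (volume.restrict (Set.Ioi 0))) := by
    have hmeas : Measurable (Function.uncurry f) := by
      unfold Function.uncurry
      simp only [f]
      fun_prop
    rw [integrable_prod_iff' hmeas.aestronglyMeasurable]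
    constructor
    · refine (ae_restrict_iff' measurableSet_Ioi).2 (Filter.Eventually.of_forall fun t ht => ?_)
      simp only [Function.uncurry, hfact]
      exact (integrableOn_cpow_mul_cexp_neg_mul hw (by simpa using ht)).const_mul _
    · have h1 := integrableOn_cpow_mul_cexp_neg_mul (s := a - w) (r := 1)
        (by simpa using ha) (by simp)
      refine (h1.norm.const_mul (Real.Gamma w.re)).congr
        ((ae_restrict_iff' measurableSet_Ioi).2 (Filter.Eventually.of_forall fun t ht => ?_))
      have hn : ∀ x ∈ Set.Ioi (0 : ℝ), ‖f x t‖ =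
          (t ^ (a.re - 1) * Real.exp (-t)) * (x ^ (w.re - 1) * Real.exp (-(t * x))) := by
        intro x hx
        rw [hfact, norm_mul, norm_mul, norm_mul, Complex.norm_cpow_eq_rpow_re_of_pos ht,
          Complex.norm_cpow_eq_rpow_re_of_pos hx, Complex.norm_exp, Complex.norm_exp]
        simp
      simp only [Function.uncurry]
      rw [setIntegral_congr_fun measurableSet_Ioi hn, integral_const_mul,
        Real.integral_rpow_mul_exp_neg_mul_Ioi hw ht, norm_mul,
        Complex.norm_cpow_eq_rpow_re_of_pos ht, Complex.norm_exp]
      simp only [one_div, Real.inv_rpow (le_of_lt ht), ← Real.rpow_neg (le_of_lt ht)]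
      rw [show (a - w - 1).re = (a.re - 1) + (-w.re) by simp; ring, Real.rpow_add ht]
      simp
      ring
  have hΓw : ∫ t : ℝ in Set.Ioi 0, (t : ℂ) ^ (a - w - 1) * Complex.exp (-t) =
      Complex.Gamma (a - w) := by
    have := integral_cpow_mul_cexp_neg_mul_Ioi (s := a - w) (r := 1)
      (by simpa using ha) (by simp)
    simpa using this
  constructor
  · have h := (hint.integral_prod_left).div_const (Complex.Gamma a)
    refine h.congr ((ae_restrict_iff' measurableSet_Ioi).2
      (Filter.Eventually.of_forall fun x h => ?_))
    simp only [Function.uncurry]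
    rw [hx x h, smul_eq_mul]
    field_simp
  · have h := integral_integral_swap hint
    rw [setIntegral_congr_fun measurableSet_Ioi hx, setIntegral_congr_fun measurableSet_Ioi ht,
      integral_const_mul, hΓw] at h
    rw [mellin, eq_div_iff hΓ, ← h, ← integral_mul_const]
    refine setIntegral_congr_fun measurableSet_Ioi fun x _ => ?_
    simp only [smul_eq_mul]; ring

theorem one_add_cpow_neg_eq_integral {a : ℂ} {c : ℝ} (hc : 0 < c) (ha : c < a.re) {x : ℝ}
    (hx : 0 < x) :
    (1 + x : ℂ) ^ (-a) = (2 * Real.pi * Complex.Gamma a)⁻¹ * ∫ t : ℝ,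
      (x : ℂ) ^ (-(c + t * Complex.I)) * (Complex.Gamma (c + t * Complex.I) * Complex.Gamma (a - (c + t * Complex.I))) := by
  have hM : ∀ t : ℝ, HasMellin (fun x : ℝ => (1 + x : ℂ) ^ (-a)) (c + t * Complex.I)
      (Complex.Gamma (c + t * Complex.I) * Complex.Gamma (a - (c + t * Complex.I)) /
        Complex.Gamma a) := fun t =>
    hasMellin_one_add_cpow_neg (by simpa using hc) (by simpa using ha)
  have hinv := mellinInv_mellin_eq c (fun x : ℝ => (1 + x : ℂ) ^ (-a)) hx
    (by simpa using (hM 0).1) ?_ ?_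
  · rw [← hinv, mellinInv]
    simp only [(hM _).2, smul_eq_mul]
    rw [mul_inv, mul_assoc, ← integral_const_mul, Complex.real_smul]
    push_cast
    rw [one_div]
    congr 2 with t
    ring
  · unfold Complex.VerticalIntegrable
    simp only [(hM _).2]
    exact (integrable_Gamma_mul_Gamma hc ha).div_const _
  · refine ContinuousAt.cpow (by fun_prop) (by fun_prop) (Or.inl ?_)
    simp; linarith

theorem integrable_Gamma_mul_Gamma_mul_Gamma {a b : ℂ} {c y : ℝ} (hc : 0 < c) (ha : c < a.re)
    (hb : c < b.re) (hy : 0 < y) :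
    Integrable fun t : ℝ => (Complex.Gamma (c + t * Complex.I) *
      Complex.Gamma (a - (c + t * Complex.I))) *
        (Complex.Gamma (b - (c + t * Complex.I)) * (y : ℂ) ^ (c + t * Complex.I)) := by
  refine (integrable_Gamma_mul_Gamma hc ha).mul_bdd (c := Real.Gamma (b.re - c) * y ^ c) ?_ ?_
  · refine Continuous.aestronglyMeasurable ?_
    refine (continuous_Gamma_vertical (sub_pos.2 hb) (by fun_prop) (by simp)).mul ?_
    exact Continuous.const_cpow (by fun_prop) (Or.inl (by simpa using hy.ne'))
  · refine Filter.Eventually.of_forall fun t => ?_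
    rw [norm_mul, Complex.norm_cpow_eq_rpow_re_of_pos hy]
    have := norm_Gamma_le_Gamma_re (s := b - (c + t * Complex.I)) (by simpa using hb)
    simp at this ⊢
    gcongr

theorem integral_Gamma_mul_Gamma_mul_Gamma {a b : ℂ} {c y : ℝ} (hc : 0 < c) (ha : c < a.re)
    (hb : c < b.re) (hy : 0 < y) :
    ∫ t : ℝ, (Complex.Gamma (c + t * Complex.I) * Complex.Gamma (a - (c + t * Complex.I))) *
        (Complex.Gamma (b - (c + t * Complex.I)) * (y : ℂ) ^ (c + t * Complex.I)) =
      2 * Real.pi * Complex.Gamma a * ∫ v : ℝ in Set.Ioi 0,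
        (v : ℂ) ^ (b - 1) * Complex.exp (-v) * (1 + (v / y : ℝ) : ℂ) ^ (-a) := by
  have hΓ : Complex.Gamma a ≠ 0 := Complex.Gamma_ne_zero_of_re_pos (hc.trans ha)
  let G : ℝ → ℂ := fun t => Complex.Gamma (c + t * Complex.I) *
    Complex.Gamma (a - (c + t * Complex.I))
  let f : ℝ → ℝ → ℂ := fun v t => ((v : ℂ) ^ (b - 1) * Complex.exp (-v)) *
    (((v / y : ℝ) : ℂ) ^ (-(c + t * Complex.I)) * G t)
  have hGc : Continuous G := (continuous_Gamma_vertical hc (by fun_prop) (by simp)).mul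
      (continuous_Gamma_vertical (sub_pos.2 ha) (by fun_prop) (by simp))
  have hfact : ∀ v ∈ Set.Ioi (0 : ℝ), ∀ t, f v t =
      (y : ℂ) ^ (c + t * Complex.I) * G t *
        ((v : ℂ) ^ (b - (c + t * Complex.I) - 1) * Complex.exp (-(1 * v))) := fun v hv t => by
    have hv' : 0 < v := hv
    simp only [f]
    rw [show b - (c + t * Complex.I) - 1 = (b - 1) + -(c + t * Complex.I) by ring,
      Complex.cpow_add (x := (v : ℂ)) _ _ (by simpa using hv'.ne'), div_eq_mul_inv,
      Complex.ofReal_mul,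
      Complex.mul_cpow_ofReal_nonneg hv'.le (by positivity), Complex.cpow_neg ((y⁻¹ : ℝ) : ℂ),
      ← Complex.inv_cpow, ← Complex.ofReal_inv, inv_inv, one_mul]
    · ring
    · rw [Complex.arg_ofReal_of_nonneg (by positivity)]; exact Real.pi_pos.ne
  have hint : Integrable (Function.uncurry f) ((volume.restrict (Set.Ioi 0)).prod volume) := by
    have h1 := (integrableOn_cpow_mul_cexp_neg_mul (s := b - c) (r := 1)
      (by simpa using hb) (by simp)).norm
    have h2 := ((integrable_Gamma_mul_Gamma hc ha).norm.const_mul (y ^ c))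
    refine (h1.mul_prod h2).mono' ?_ ?_
    · have : Measurable (Function.uncurry f) := by
        have := hGc.measurable
        unfold Function.uncurry
        simp only [f]
        fun_prop
      exact this.aestronglyMeasurable
    · have hae : ∀ᵐ p ∂((volume.restrict (Set.Ioi (0:ℝ))).prod (volume : Measure ℝ)), 0 < p.1 :=
        Measure.quasiMeasurePreserving_fst.ae (ae_restrict_mem measurableSet_Ioi)
      filter_upwards [hae] with p hp
      simp only [Function.uncurry]
      rw [hfact _ hp]
      simp only [norm_mul]
      rw [Complex.norm_cpow_eq_rpow_re_of_pos hp, Complex.norm_cpow_eq_rpow_re_of_pos hp,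
        Complex.norm_cpow_eq_rpow_re_of_pos hy]
      simp [G]
      apply le_of_eq
      ring
  have h := integral_integral_swap hint
  have hL : ∀ v ∈ Set.Ioi (0 : ℝ), ∫ t, f v t = 2 * Real.pi * Complex.Gamma a *
      ((v : ℂ) ^ (b - 1) * Complex.exp (-v) * (1 + (v / y : ℝ) : ℂ) ^ (-a)) := fun v hv => by
    simp only [f]
    rw [integral_const_mul, one_add_cpow_neg_eq_integral hc ha (div_pos hv hy)]
    have h2 : 2 * Real.pi * Complex.Gamma a ≠ 0 := by simp [Real.pi_ne_zero, hΓ]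
    rw [mul_left_comm, mul_inv_cancel_left₀ h2]
  have hR : ∀ t : ℝ, ∫ v : ℝ in Set.Ioi 0, f v t = G t *
      (Complex.Gamma (b - (c + t * Complex.I)) * (y : ℂ) ^ (c + t * Complex.I)) := fun t => by
    rw [setIntegral_congr_fun measurableSet_Ioi fun v hv => hfact v hv t, integral_const_mul,
      integral_cpow_mul_cexp_neg_mul_Ioi (by simpa using hb) (by simp), Complex.one_cpow]
    ring
  rw [setIntegral_congr_fun measurableSet_Ioi hL, integral_const_mul] at h
  simp only [hR] at h
  exact h.symm

theorem one_add_mul_I_mem_slitPlane (x : ℝ) : 1 + x * Complex.I ∈ Complex.slitPlane :=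
  Or.inl (by simp)

theorem one_sub_mul_I_mem_slitPlane (x : ℝ) : 1 - x * Complex.I ∈ Complex.slitPlane :=
  Or.inl (by simp)

theorem norm_one_add_mul_I_cpow_neg_le (s : ℂ) (x : ℝ) :
    ‖(1 + x * Complex.I) ^ (-s)‖ ≤ Real.exp (Real.pi * |s.im|) * (1 + ‖x‖ ^ 2) ^ (-s.re / 2) := by
  have hz : (1 + x * Complex.I) ≠ 0 := Complex.slitPlane_ne_zero (one_add_mul_I_mem_slitPlane x)
  have hn : ‖(1 + x * Complex.I)‖ = (1 + ‖x‖ ^ 2) ^ (1 / 2 : ℝ) := by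
    have := Complex.norm_add_mul_I 1 x
    rw [← Real.sqrt_eq_rpow, Real.norm_eq_abs, sq_abs]
    simpa using this
  rw [Complex.norm_cpow_of_ne_zero hz, hn, ← Real.rpow_mul (by positivity), div_eq_mul_inv,
    ← Real.exp_neg, mul_comm]
  have h1 : -(Complex.arg (1 + x * Complex.I) * (-s).im) ≤ Real.pi * |s.im| := by
    rw [Complex.neg_im, mul_neg, neg_neg]
    refine (le_abs_self _).trans ?_
    rw [abs_mul]
    gcongr
    exact Complex.abs_arg_le_pi _
  rw [show 1 / 2 * (-s).re = -s.re / 2 by rw [Complex.neg_re]; ring]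
  gcongr

theorem norm_one_sub_mul_I_cpow_neg_le (s : ℂ) (x : ℝ) :
    ‖(1 - x * Complex.I) ^ (-s)‖ ≤ Real.exp (Real.pi * |s.im|) * (1 + ‖x‖ ^ 2) ^ (-s.re / 2) := by
  simpa [sub_eq_add_neg] using norm_one_add_mul_I_cpow_neg_le s (-x)

theorem continuous_one_add_mul_I_cpow (s : ℂ) :
    Continuous fun x : ℝ => (1 + x * Complex.I) ^ s :=
  Continuous.cpow (by fun_prop) (by fun_prop) one_add_mul_I_mem_slitPlane

theorem continuous_one_sub_mul_I_cpow (s : ℂ) :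
    Continuous fun x : ℝ => (1 - x * Complex.I) ^ s :=
  Continuous.cpow (by fun_prop) (by fun_prop) one_sub_mul_I_mem_slitPlane

theorem integrable_one_add_mul_I_cpow_mul {a b : ℂ} (h : 1 < a.re + b.re) :
    Integrable fun x : ℝ => (1 + x * Complex.I) ^ (-a) * (1 - x * Complex.I) ^ (-b) := by
  have hi := integrable_rpow_neg_one_add_norm_sq (μ := (volume : Measure ℝ)) (r := a.re + b.re)
    (by simpa using h)
  refine (hi.const_mul (Real.exp (Real.pi * |a.im|) * Real.exp (Real.pi * |b.im|))).mono'
    ((continuous_one_add_mul_I_cpow _).mul (continuous_one_sub_mul_I_cpow _)).aestronglyMeasurable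
    (Filter.Eventually.of_forall fun x => ?_)
  rw [norm_mul]
  refine (mul_le_mul (norm_one_add_mul_I_cpow_neg_le a x) (norm_one_sub_mul_I_cpow_neg_le b x)
    (norm_nonneg _) (by positivity)).trans (le_of_eq ?_)
  rw [show -(a.re + b.re) / 2 = -a.re / 2 + -b.re / 2 by ring, Real.rpow_add (by positivity)]
  ring

theorem integrable_one_add_mul_I_cpow {a : ℂ} (h : 1 < a.re) :
    Integrable fun x : ℝ => (1 + x * Complex.I) ^ (-a) := by
  simpa using integrable_one_add_mul_I_cpow_mul (a := a) (b := 0) (by simpa using h)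

/-- Fourier inversion for the Gamma density. -/
theorem integral_cexp_mul_one_add_mul_I_cpow {a : ℂ} (ha : 1 < a.re) {v : ℝ} (hv : 0 < v) :
    ∫ x : ℝ, Complex.exp (v * x * Complex.I) * (1 + x * Complex.I) ^ (-a) =
      2 * Real.pi / Complex.Gamma a * ((v : ℂ) ^ (a - 1) * Complex.exp (-v)) := by
  have ha0 : 0 < a.re := one_pos.trans ha
  have hΓ : Complex.Gamma a ≠ 0 := Complex.Gamma_ne_zero_of_re_pos ha0
  let f : ℝ → ℂ := (Set.Ioi 0).indicator fun t : ℝ => (t : ℂ) ^ (a - 1) * Complex.exp (-t)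
  have hf : Integrable f := by
    have := integrableOn_cpow_mul_cexp_neg_mul (s := a) (r := 1) ha0 (by simp)
    simp only [one_mul] at this
    exact this.integrable_indicator measurableSet_Ioi
  have hF : ∀ η : ℝ, FourierTransform.fourier f η =
      (1 + (2 * Real.pi * η : ℝ) * Complex.I) ^ (-a) * Complex.Gamma a := fun η => by
    rw [Real.fourier_eq', ← integral_cpow_mul_cexp_neg_mul_Ioi ha0 (by simp),
      ← integral_indicator measurableSet_Ioi]
    congr 1 with t
    by_cases ht : t ∈ Set.Ioi (0 : ℝ)
    · simp only [f, Set.indicator_of_mem ht, smul_eq_mul, RCLike.inner_apply, conj_trivial]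
      rw [mul_left_comm, ← Complex.exp_add]
      congr 2
      push_cast
      ring
    · simp only [f, Set.indicator_of_notMem ht, smul_zero]
  have hFi : Integrable (FourierTransform.fourier f) := by
    rw [funext hF]
    exact ((integrable_one_add_mul_I_cpow ha).comp_mul_left'
      (by positivity : 2 * Real.pi ≠ 0)).mul_const _
  have hcont : ContinuousAt f v := by
    have : (fun t : ℝ => (t : ℂ) ^ (a - 1) * Complex.exp (-t)) =ᶠ[nhds v] f := by
      filter_upwards [Ioi_mem_nhds hv] with t ht
      simp only [f, Set.indicator_of_mem ht]
    refine ContinuousAt.congr (ContinuousAt.mul ?_ (by fun_prop)) this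
    exact Complex.continuousAt_ofReal_cpow_const _ _ (Or.inr hv.ne')
  have hinv := hf.fourierInv_fourier_eq hFi hcont
  rw [Real.fourierInv_eq'] at hinv
  simp only [hF, f, Set.indicator_of_mem (Set.mem_Ioi.2 hv), smul_eq_mul, RCLike.inner_apply,
    conj_trivial] at hinv
  have hsub := Measure.integral_comp_mul_left
    (fun x : ℝ => Complex.exp (v * x * Complex.I) * (1 + x * Complex.I) ^ (-a)) (2 * Real.pi)
  rw [← hinv, eq_comm, div_mul_eq_mul_div, div_eq_iff hΓ]
  rw [abs_of_pos (by positivity), eq_inv_smul_iff₀ (by positivity), Complex.real_smul] at hsub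
  rw [← hsub, mul_assoc ((2 * Real.pi : ℝ) : ℂ), ← integral_mul_const]
  push_cast
  congr 2 with t
  rw [← mul_assoc]
  congr 3
  ring

theorem integral_whittaker_of_one_lt {a b : ℂ} (ha : 1 < a.re) (hb : 0 < b.re) {x : ℝ}
    (hx : 0 < x) :
    Complex.Gamma b * ∫ ξ : ℝ, Complex.exp (x * ξ * Complex.I) *
        ((1 + ξ * Complex.I) ^ (-a) * (1 - ξ * Complex.I) ^ (-b)) =
      2 * Real.pi / Complex.Gamma a * Complex.exp (-x) * ∫ u : ℝ in Set.Ioi 0,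
        (u : ℂ) ^ (b - 1) * ((x + u : ℝ) : ℂ) ^ (a - 1) * Complex.exp (-(2 * u)) := by
  let f : ℝ → ℝ → ℂ := fun u ξ => ((u : ℂ) ^ (b - 1) * Complex.exp (-u)) *
    (Complex.exp ((x + u : ℝ) * ξ * Complex.I) * (1 + ξ * Complex.I) ^ (-a))
  have hint : Integrable (Function.uncurry f) ((volume.restrict (Set.Ioi 0)).prod volume) := by
    have h1 := (integrableOn_cpow_mul_cexp_neg_mul (s := b) (r := 1) hb (by simp)).norm
    have h2 := (integrable_one_add_mul_I_cpow ha).norm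
    refine (h1.mul_prod h2).mono' ?_ ?_
    · have : Measurable (Function.uncurry f) := by
        have := (continuous_one_add_mul_I_cpow (-a)).measurable
        unfold Function.uncurry
        simp only [f]
        fun_prop
      exact this.aestronglyMeasurable
    · refine Filter.Eventually.of_forall fun p => le_of_eq ?_
      simp only [Function.uncurry, f, norm_mul, one_mul]
      rw [← Complex.ofReal_mul, Complex.norm_exp_ofReal_mul_I, one_mul]
  have h := integral_integral_swap hint
  have hL : ∀ u ∈ Set.Ioi (0 : ℝ), ∫ ξ, f u ξ = 2 * Real.pi / Complex.Gamma a * Complex.exp (-x) *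
      ((u : ℂ) ^ (b - 1) * ((x + u : ℝ) : ℂ) ^ (a - 1) * Complex.exp (-(2 * u))) := fun u hu => by
    simp only [f]
    rw [integral_const_mul, integral_cexp_mul_one_add_mul_I_cpow ha (add_pos hx hu),
      show (-((x + u : ℝ) : ℂ)) = -x + -u by push_cast; ring,
      show (-(2 * u : ℂ)) = -u + -u by ring, Complex.exp_add, Complex.exp_add]
    ring
  have hR : ∀ ξ : ℝ, ∫ u : ℝ in Set.Ioi 0, f u ξ = Complex.Gamma b *
      (Complex.exp (x * ξ * Complex.I) *
        ((1 + ξ * Complex.I) ^ (-a) * (1 - ξ * Complex.I) ^ (-b))) := fun ξ => by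
    have : ∀ u : ℝ, f u ξ = (Complex.exp (x * ξ * Complex.I) * (1 + ξ * Complex.I) ^ (-a)) *
        ((u : ℂ) ^ (b - 1) * Complex.exp (-((1 - ξ * Complex.I) * u))) := fun u => by
      simp only [f]
      rw [show ((x + u : ℝ) : ℂ) * ξ * Complex.I = x * ξ * Complex.I + u * ξ * Complex.I by
          push_cast; ring, show -((1 - ξ * Complex.I) * u) = -u + u * ξ * Complex.I by ring,
        Complex.exp_add, Complex.exp_add]
      ring
    simp only [this]
    rw [integral_const_mul, integral_cpow_mul_cexp_neg_mul_Ioi hb (by simp)]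
    ring
  rw [setIntegral_congr_fun measurableSet_Ioi hL, integral_const_mul] at h
  simp only [hR] at h
  rw [integral_const_mul] at h
  exact h.symm

theorem exists_add_rpow_le_mul_exp (p : ℝ) {x : ℝ} (hx : 0 < x) :
    ∃ C, 0 ≤ C ∧ ∀ u, 0 < u → (x + u) ^ p ≤ C * Real.exp u := by
  rcases le_or_gt p 0 with hp | hp
  · refine ⟨x ^ p, by positivity, fun u hu => ?_⟩
    have h1 := Real.rpow_le_rpow_of_nonpos hx (by linarith : x ≤ x + u) hp
    have h2 := Real.one_le_exp hu.le
    have h3 : 0 ≤ x ^ p := by positivity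
    nlinarith
  · refine ⟨Real.exp (p * Real.log p - p + x), by positivity, fun u hu => ?_⟩
    have hz : 0 < x + u := by positivity
    rw [Real.rpow_def_of_pos hz, ← Real.exp_add]
    apply Real.exp_le_exp.2
    have h1 := Real.log_le_sub_one_of_pos (div_pos hz hp)
    rw [Real.log_div hz.ne' hp.ne'] at h1
    have h2 := mul_le_mul_of_nonneg_left h1 hp.le
    rw [mul_sub, mul_sub, mul_div_cancel₀ _ hp.ne'] at h2
    linarith

theorem integrableOn_whittaker (a : ℂ) {b : ℂ} (hb : 0 < b.re) {x : ℝ} (hx : 0 < x) :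
    IntegrableOn (fun u : ℝ => (u : ℂ) ^ (b - 1) * ((x + u : ℝ) : ℂ) ^ (a - 1) *
      Complex.exp (-(2 * u))) (Set.Ioi 0) := by
  obtain ⟨C, -, hC⟩ := exists_add_rpow_le_mul_exp (a - 1).re hx
  have h1 := (integrableOn_cpow_mul_cexp_neg_mul (s := b) (r := 1) hb (by simp)).norm
  refine (h1.const_mul C).mono' (Measurable.aestronglyMeasurable (by fun_prop))
    ((ae_restrict_iff' measurableSet_Ioi).2 (Filter.Eventually.of_forall fun u hu => ?_))
  simp only [norm_mul]
  rw [Complex.norm_cpow_eq_rpow_re_of_pos hu, Complex.norm_cpow_eq_rpow_re_of_pos (add_pos hx hu),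
    Complex.norm_exp, Complex.norm_exp]
  have h2 := hC u hu
  have h3 : 0 ≤ u ^ (b - 1).re := Real.rpow_nonneg (le_of_lt hu) _
  calc _ ≤ u ^ (b - 1).re * (C * Real.exp u) * Real.exp (-(2 * (u : ℂ))).re := by gcongr
    _ = _ := by
      have : Real.exp u * Real.exp (-(2 * u)) = Real.exp (-u) := by
        rw [← Real.exp_add]; ring_nf
      simp
      rw [← this]; ring

theorem integral_whittaker {a b : ℂ} (hab : 1 < a.re + b.re) (hb : 0 < b.re) {x : ℝ}
    (hx : 0 < x) :
    Complex.Gamma b * ∫ ξ : ℝ, Complex.exp (x * ξ * Complex.I) *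
        ((1 + ξ * Complex.I) ^ (-a) * (1 - ξ * Complex.I) ^ (-b)) =
      2 * Real.pi / Complex.Gamma a * Complex.exp (-x) * ∫ u : ℝ in Set.Ioi 0,
        (u : ℂ) ^ (b - 1) * ((x + u : ℝ) : ℂ) ^ (a - 1) * Complex.exp (-(2 * u)) := by
  set U : Set ℂ := {z | 1 - b.re < z.re} with hUdef
  have hU : IsOpen U := isOpen_lt continuous_const Complex.continuous_re
  have hconv : Convex ℝ U := convex_halfSpace_re_gt _
  have hL : ∀ z : ℂ, ∀ ξ : ℝ, Complex.exp (x * ξ * Complex.I) *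
        ((1 + ξ * Complex.I) ^ (-z) * (1 - ξ * Complex.I) ^ (-b)) =
      Complex.exp (z * (-Complex.log (1 + ξ * Complex.I))) *
        (Complex.exp (x * ξ * Complex.I) * (1 - ξ * Complex.I) ^ (-b)) := fun z ξ => by
    rw [Complex.cpow_def_of_ne_zero
      (Complex.slitPlane_ne_zero (one_add_mul_I_mem_slitPlane ξ)) (-z)]
    rw [mul_left_comm]
    congr 2
    ring
  have hR : ∀ z : ℂ, ∀ u ∈ Set.Ioi (0 : ℝ), (u : ℂ) ^ (b - 1) * ((x + u : ℝ) : ℂ) ^ (z - 1) *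
      Complex.exp (-(2 * u)) = Complex.exp (z * Complex.log ((x + u : ℝ) : ℂ)) *
        ((u : ℂ) ^ (b - 1) * ((x + u : ℝ) : ℂ)⁻¹ * Complex.exp (-(2 * u))) := fun z u hu => by
    have : ((x + u : ℝ) : ℂ) ≠ 0 := Complex.ofReal_ne_zero.2 (add_pos hx hu).ne'
    rw [Complex.cpow_sub _ _ this, Complex.cpow_one, Complex.cpow_def_of_ne_zero this z,
      mul_comm (Complex.log _) z]
    ring
  have hdL : DifferentiableOn ℂ (fun z : ℂ => Complex.Gamma b * ∫ ξ : ℝ,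
      Complex.exp (x * ξ * Complex.I) *
        ((1 + ξ * Complex.I) ^ (-z) * (1 - ξ * Complex.I) ^ (-b))) U := by
    refine DifferentiableOn.const_mul ?_ _
    simp only [hL]
    refine differentiableOn_integral_exp_mul hU ?_ ?_ fun z hz => ?_
    · exact (Continuous.clog (by fun_prop) one_add_mul_I_mem_slitPlane).neg.aestronglyMeasurable
    · exact ((by fun_prop : Continuous fun ξ : ℝ => Complex.exp (x * ξ * Complex.I)).mul
        (continuous_one_sub_mul_I_cpow _)).aestronglyMeasurable
    · simp only [← hL]
      refine (integrable_one_add_mul_I_cpow_mul (a := z) (b := b) (by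
        simp only [hUdef, Set.mem_ofPred_eq] at hz; linarith)).bdd_mul (c := 1) ?_ ?_
      · exact (by fun_prop : Continuous fun ξ : ℝ =>
          Complex.exp (x * ξ * Complex.I)).aestronglyMeasurable
      · refine Filter.Eventually.of_forall fun ξ => ?_
        rw [← Complex.ofReal_mul, Complex.norm_exp_ofReal_mul_I]
  have hdR : DifferentiableOn ℂ (fun z : ℂ => 2 * Real.pi / Complex.Gamma z * Complex.exp (-x) *
      ∫ u : ℝ in Set.Ioi 0,
        (u : ℂ) ^ (b - 1) * ((x + u : ℝ) : ℂ) ^ (z - 1) * Complex.exp (-(2 * u))) U := by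
    refine DifferentiableOn.mul ?_ ?_
    · simp only [div_eq_mul_inv]
      exact ((Complex.differentiable_one_div_Gamma.const_mul _).mul_const _).differentiableOn
    · have : ∀ z : ℂ, _ := fun z => setIntegral_congr_fun (μ := volume) measurableSet_Ioi (hR z)
      simp only [this]
      refine differentiableOn_integral_exp_mul hU
        (Measurable.aestronglyMeasurable (by fun_prop))
        (Measurable.aestronglyMeasurable (by fun_prop)) fun z _ => ?_
      exact (integrableOn_congr_fun (hR z) measurableSet_Ioi).1 (integrableOn_whittaker z hb hx)
  refine (hdL.analyticOnNhd hU).eqOn_of_preconnected_of_eventuallyEq (hdR.analyticOnNhd hU)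
    hconv.isPreconnected (z₀ := 2) ?_ ?_ (show a ∈ U from ?_)
  · simp only [hUdef, Set.mem_ofPred_eq, Complex.re_ofNat]; linarith
  · have : {z : ℂ | 1 < z.re} ∈ nhds (2 : ℂ) :=
      (isOpen_lt continuous_const Complex.continuous_re).mem_nhds (by simp)
    filter_upwards [this] with z hz using integral_whittaker_of_one_lt hz hb hx
  · simp only [hUdef, Set.mem_ofPred_eq]; linarith

theorem abs_arg_one_add_mul_I_lt (x : ℝ) : |(1 + x * Complex.I).arg| < Real.pi / 2 :=
  Complex.abs_arg_lt_pi_div_two_iff.2 (Or.inl (by simp))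

theorem log_ofReal_sub_I (x : ℝ) :
    Complex.log (x - Complex.I) = Complex.log (1 + x * Complex.I) - Real.pi / 2 * Complex.I := by
  have h := abs_lt.1 (abs_arg_one_add_mul_I_lt x)
  have hpi := Real.pi_pos
  have him : (Complex.log (1 + x * Complex.I) - Real.pi / 2 * Complex.I).im =
      (1 + x * Complex.I).arg - Real.pi / 2 := by
    simp [Complex.log_im]
  rw [← Complex.log_exp (x := Complex.log (1 + x * Complex.I) - Real.pi / 2 * Complex.I)
    (by rw [him]; linarith) (by rw [him]; linarith), Complex.exp_sub,
    Complex.exp_log (Complex.slitPlane_ne_zero (one_add_mul_I_mem_slitPlane x)),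
    Complex.exp_pi_div_two_mul_I, eq_comm]
  congr 1
  rw [div_eq_iff Complex.I_ne_zero]
  linear_combination Complex.I_sq

theorem log_ofReal_add_I (x : ℝ) :
    Complex.log (x + Complex.I) = Complex.log (1 - x * Complex.I) + Real.pi / 2 * Complex.I := by
  have h := abs_lt.1 (abs_arg_one_add_mul_I_lt (-x))
  rw [Complex.ofReal_neg, neg_mul, ← sub_eq_add_neg] at h
  have hpi := Real.pi_pos
  have him : (Complex.log (1 - x * Complex.I) + Real.pi / 2 * Complex.I).im =
      (1 - x * Complex.I).arg + Real.pi / 2 := by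
    simp [Complex.log_im]
  rw [← Complex.log_exp (x := Complex.log (1 - x * Complex.I) + Real.pi / 2 * Complex.I)
    (by rw [him]; linarith) (by rw [him]; linarith), Complex.exp_add,
    Complex.exp_log (Complex.slitPlane_ne_zero (one_sub_mul_I_mem_slitPlane x)),
    Complex.exp_pi_div_two_mul_I]
  congr 1
  linear_combination x * Complex.I_sq

theorem log_ofReal_sq_add_one (x : ℝ) :
    Complex.log ((x ^ 2 + 1 : ℝ) : ℂ) =
      Complex.log (1 + x * Complex.I) + Complex.log (1 - x * Complex.I) := by
  have h1 := abs_lt.1 (abs_arg_one_add_mul_I_lt x)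
  have h2 := abs_lt.1 (abs_arg_one_add_mul_I_lt (-x))
  rw [Complex.ofReal_neg, neg_mul, ← sub_eq_add_neg] at h2
  rw [← Complex.log_mul (Complex.slitPlane_ne_zero (one_add_mul_I_mem_slitPlane x))
    (Complex.slitPlane_ne_zero (one_sub_mul_I_mem_slitPlane x)) ⟨by linarith, by linarith⟩]
  congr 1
  push_cast
  linear_combination (x : ℂ) ^ 2 * Complex.I_sq

theorem Wh_integrand_eq (μ ν : ℂ) (y ξ : ℝ) :
    Complex.exp (-Complex.I * (y : ℂ) * (ξ : ℂ) / 2) *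
        ((ξ ^ 2 + 1 : ℝ) : ℂ) ^ (-ν - 1 / 2) *
        Complex.exp (μ * (Complex.log ((ξ : ℂ) - Complex.I) - Complex.log ((ξ : ℂ) + Complex.I))) =
      Complex.exp (-(Complex.I * Real.pi * μ)) *
        (Complex.exp ((y / 2 : ℝ) * (-ξ : ℝ) * Complex.I) *
          ((1 + (-ξ : ℝ) * Complex.I) ^ (-(μ + ν + 1 / 2)) *
            (1 - (-ξ : ℝ) * Complex.I) ^ (-(ν - μ + 1 / 2)))) := by
  have h0 : ((ξ ^ 2 + 1 : ℝ) : ℂ) ≠ 0 := Complex.ofReal_ne_zero.2 (by positivity)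
  rw [Complex.ofReal_neg, neg_mul (ξ : ℂ), sub_neg_eq_add, ← sub_eq_add_neg (1 : ℂ),
    Complex.cpow_def_of_ne_zero h0, log_ofReal_sub_I, log_ofReal_add_I, log_ofReal_sq_add_one,
    Complex.cpow_def_of_ne_zero (Complex.slitPlane_ne_zero (one_add_mul_I_mem_slitPlane ξ)),
    Complex.cpow_def_of_ne_zero (Complex.slitPlane_ne_zero (one_sub_mul_I_mem_slitPlane ξ))]
  simp only [← Complex.exp_add]
  congr 1
  push_cast
  ring

theorem integral_Ioi_cpow_mul_add_cpow_mul_cexp (a b : ℂ) {y : ℝ} (hy : 0 < y) :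
    ∫ u : ℝ in Set.Ioi 0, (u : ℂ) ^ (b - 1) * ((y / 2 + u : ℝ) : ℂ) ^ (a - 1) *
        Complex.exp (-(2 * u)) =
      (2 : ℂ) ^ (-b) * ((y / 2 : ℝ) : ℂ) ^ (a - 1) *
        ∫ v : ℝ in Set.Ioi 0, (v : ℂ) ^ (b - 1) * Complex.exp (-v) *
          (1 + (v / y : ℝ) : ℂ) ^ (-(1 - a)) := by
  have h := integral_comp_mul_left_Ioi (fun v : ℝ => (v : ℂ) ^ (b - 1) * Complex.exp (-v) *
          (1 + (v / y : ℝ) : ℂ) ^ (-(1 - a))) 0 (two_pos : (0 : ℝ) < 2)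
  rw [mul_zero, eq_inv_smul_iff₀ two_ne_zero, Complex.real_smul] at h
  rw [← h, ← mul_assoc, ← integral_const_mul]
  refine setIntegral_congr_fun measurableSet_Ioi fun u hu => ?_
  have hu : 0 < u := hu
  have h1 : (((2 * u : ℝ) : ℂ)) ^ (b - 1) = (2 : ℂ) ^ (b - 1) * (u : ℂ) ^ (b - 1) := by
    rw [Complex.ofReal_mul, Complex.mul_cpow_ofReal_nonneg two_pos.le hu.le, Complex.ofReal_ofNat]
  have h2 : ((y / 2 + u : ℝ) : ℂ) ^ (a - 1) =
      ((y / 2 : ℝ) : ℂ) ^ (a - 1) * (1 + (2 * u / y : ℝ) : ℂ) ^ (a - 1) := by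
    rw [← Complex.ofReal_one, ← Complex.ofReal_add,
      ← Complex.mul_cpow_ofReal_nonneg (by positivity) (by positivity), ← Complex.ofReal_mul]
    congr 2
    field_simp
  have h3 : (2 : ℂ) ^ (-b) * 2 * 2 ^ (b - 1) = 1 := by
    rw [Complex.cpow_sub _ _ two_ne_zero, Complex.cpow_neg, Complex.cpow_one]
    have : (2 : ℂ) ^ b ≠ 0 := by simp [Complex.cpow_eq_zero_iff]
    field_simp
  rw [h1, h2, neg_sub, show -((2 * u : ℝ) : ℂ) = -(2 * u) by push_cast; ring]
  rw [Complex.ofReal_ofNat]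
  linear_combination (-((u : ℂ) ^ (b - 1) * ((y / 2 : ℝ) : ℂ) ^ (a - 1) *
    (1 + (2 * u / y : ℝ) : ℂ) ^ (a - 1) * Complex.exp (-(2 * u)))) * h3

theorem cpow_const_identity (μ ν : ℂ) {y : ℝ} (hy : 0 < y) :
    ((y / 4 : ℝ) : ℂ) ^ ((1 : ℂ) / 2 - ν) * (2 * ((2 : ℂ) ^ (-(ν - μ + 1 / 2)) *
      ((y / 2 : ℝ) : ℂ) ^ (μ + ν + 1 / 2 - 1))) = (y : ℂ) ^ μ := by
  have h2 : (2 : ℂ) = Complex.exp (Real.log 2 : ℝ) := by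
    rw [← Complex.ofReal_exp, Real.exp_log two_pos, Complex.ofReal_ofNat]
  have h4 : Real.log 4 = 2 * Real.log 2 := by
    rw [show (4 : ℝ) = 2 ^ 2 by norm_num, Real.log_pow]; norm_num
  have hl2 : Complex.log 2 = (Real.log 2 : ℝ) := by
    rw [Complex.ofReal_log two_pos.le, Complex.ofReal_ofNat]
  rw [Complex.cpow_def_of_ne_zero (Complex.ofReal_ne_zero.2 (by positivity)),
    Complex.cpow_def_of_ne_zero two_ne_zero,
    Complex.cpow_def_of_ne_zero (Complex.ofReal_ne_zero.2 (by positivity)),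
    Complex.cpow_def_of_ne_zero (Complex.ofReal_ne_zero.2 hy.ne'),
    ← Complex.ofReal_log (by positivity), ← Complex.ofReal_log (by positivity),
    ← Complex.ofReal_log hy.le, hl2, Real.log_div hy.ne' (by norm_num),
    Real.log_div hy.ne' two_ne_zero, h4]
  have hexp : ∀ u v w : ℂ, Complex.exp u * (2 * (Complex.exp v * Complex.exp w)) =
      Complex.exp (u + Real.log 2 + v + w) := fun u v w => by
    rw [Complex.exp_add, Complex.exp_add, Complex.exp_add, ← h2]
    ring
  rw [hexp]
  congr 1
  push_cast
  ring

theorem Wh_eq_integral_Ioi {μ ν : ℂ} (hν : 0 < ν.re) (hB : 0 < (ν - μ + 1 / 2).re)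
    (hpole : ∀ n : ℕ, μ + ν + 1 / 2 ≠ -(n : ℂ)) {y : ℝ} (hy : 0 < y) :
    Wh μ ν y = (y : ℂ) ^ μ * Complex.exp (-(y : ℂ) / 2) / Complex.Gamma (ν - μ + 1 / 2) *
      ∫ v : ℝ in Set.Ioi 0, (v : ℂ) ^ (ν - μ + 1 / 2 - 1) * Complex.exp (-v) *
          (1 + (v / y : ℝ) : ℂ) ^ (-(1 - (μ + ν + 1 / 2))) := by
  have hΓA : Complex.Gamma (μ + ν + 1 / 2) ≠ 0 := Complex.Gamma_ne_zero hpole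
  have hΓB : Complex.Gamma (ν - μ + 1 / 2) ≠ 0 := Complex.Gamma_ne_zero_of_re_pos hB
  have hmain := integral_whittaker (a := μ + ν + 1 / 2) (b := ν - μ + 1 / 2)
    (by simp; linarith) hB (half_pos hy)
  rw [integral_Ioi_cpow_mul_add_cpow_mul_cexp _ _ hy, mul_comm, ← eq_div_iff hΓB] at hmain
  unfold Wh
  simp only [Wh_integrand_eq]
  rw [integral_const_mul, integral_neg_eq_self (fun ξ : ℝ =>
    Complex.exp ((y / 2 : ℝ) * ξ * Complex.I) * ((1 + ξ * Complex.I) ^ (-(μ + ν + 1 / 2)) *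
            (1 - ξ * Complex.I) ^ (-(ν - μ + 1 / 2)))), hmain, ← cpow_const_identity μ ν hy,
    Complex.exp_neg (Complex.I * Real.pi * μ),
    show -((y / 2 : ℝ) : ℂ) = -(y : ℂ) / 2 by push_cast; ring]
  have hpi : (Real.pi : ℂ) ≠ 0 := Complex.ofReal_ne_zero.2 Real.pi_ne_zero
  have hexp := Complex.exp_ne_zero (Complex.I * Real.pi * μ)
  generalize Complex.Gamma (μ + ν + 1 / 2) = G, Complex.Gamma (ν - μ + 1 / 2) = H at hΓA hΓB ⊢
  generalize integral (G := ℂ) (volume.restrict (Set.Ioi (0 : ℝ))) _ = K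
  field_simp

/-- Mellin–Barnes representation of the Whittaker function. -/
theorem whittaker_mellin_barnes (μ ν : ℂ) (hν : 0 < ν.re) (hμν : μ.re + ν.re < 1 / 2)
    (hpole : ∀ n : ℕ, μ + ν + 1 / 2 ≠ -(n : ℂ)) (y : ℝ) (hy : 0 < y)
    (c : ℝ) (hc0 : 0 < c) (hc1 : c < 1 / 2 - μ.re - ν.re) :
    Integrable (fun t : ℝ =>
      Complex.Gamma (-(c : ℂ) + (t : ℂ) * Complex.I - μ + ν + 1 / 2) *
          Complex.Gamma (-(c : ℂ) + (t : ℂ) * Complex.I - μ - ν + 1 / 2) *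
          Complex.Gamma ((c : ℂ) - (t : ℂ) * Complex.I) /
            (Complex.Gamma (1 / 2 - μ + ν) * Complex.Gamma (1 / 2 - μ - ν)) *
        (y : ℂ) ^ ((c : ℂ) - (t : ℂ) * Complex.I)) ∧
    Wh μ ν y =
      (y : ℂ) ^ μ * Complex.exp (-(y : ℂ) / 2) / (2 * (Real.pi : ℂ)) *
        ∫ t : ℝ,
          Complex.Gamma (-(c : ℂ) + (t : ℂ) * Complex.I - μ + ν + 1 / 2) *
              Complex.Gamma (-(c : ℂ) + (t : ℂ) * Complex.I - μ - ν + 1 / 2) *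
              Complex.Gamma ((c : ℂ) - (t : ℂ) * Complex.I) /
                (Complex.Gamma (1 / 2 - μ + ν) * Complex.Gamma (1 / 2 - μ - ν)) *
            (y : ℂ) ^ ((c : ℂ) - (t : ℂ) * Complex.I) := by
  have ha : c < (1 / 2 - μ - ν).re := by simpa using hc1
  have hb : c < (1 / 2 - μ + ν).re := by
    simp only [Complex.sub_re, Complex.add_re] at ha ⊢
    linarith
  let f : ℝ → ℂ := fun t =>
    (Complex.Gamma (c + t * Complex.I) * Complex.Gamma (1 / 2 - μ - ν - (c + t * Complex.I))) *
      (Complex.Gamma (1 / 2 - μ + ν - (c + t * Complex.I)) * (y : ℂ) ^ (c + t * Complex.I))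
  have hf : Integrable f := integrable_Gamma_mul_Gamma_mul_Gamma hc0 ha hb hy
  have hfi := integral_Gamma_mul_Gamma_mul_Gamma hc0 ha hb hy
  have hΓa := Complex.Gamma_ne_zero_of_re_pos (hc0.trans ha)
  have hΓb := Complex.Gamma_ne_zero_of_re_pos (hc0.trans hb)
  have hg : ∀ t : ℝ, Complex.Gamma (-(c : ℂ) + (t : ℂ) * Complex.I - μ + ν + 1 / 2) *
          Complex.Gamma (-(c : ℂ) + (t : ℂ) * Complex.I - μ - ν + 1 / 2) *
          Complex.Gamma ((c : ℂ) - (t : ℂ) * Complex.I) /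
            (Complex.Gamma (1 / 2 - μ + ν) * Complex.Gamma (1 / 2 - μ - ν)) *
        (y : ℂ) ^ ((c : ℂ) - (t : ℂ) * Complex.I) =
      (Complex.Gamma (1 / 2 - μ + ν) * Complex.Gamma (1 / 2 - μ - ν))⁻¹ * f (-t) := fun t => by
    simp only [f]
    rw [show (c : ℂ) + ((-t : ℝ) : ℂ) * Complex.I = c - t * Complex.I by push_cast; ring,
      show -(c : ℂ) + t * Complex.I - μ + ν + 1 / 2 = 1 / 2 - μ + ν - (c - t * Complex.I) by ring,
      show -(c : ℂ) + t * Complex.I - μ - ν + 1 / 2 = 1 / 2 - μ - ν - (c - t * Complex.I) by ring]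
    ring
  simp only [hg]
  refine ⟨hf.comp_neg.const_mul _, ?_⟩
  rw [integral_const_mul, integral_neg_eq_self f, hfi, Wh_eq_integral_Ioi hν _ hpole hy,
    show ν - μ + 1 / 2 = 1 / 2 - μ + ν by ring,
    show 1 - (μ + ν + 1 / 2) = 1 / 2 - μ - ν by ring]
  · have hpi : (Real.pi : ℂ) ≠ 0 := Complex.ofReal_ne_zero.2 Real.pi_ne_zero
    generalize Complex.Gamma (1 / 2 - μ - ν) = G, Complex.Gamma (1 / 2 - μ + ν) = H at hΓa hΓb ⊢
    generalize integral (G := ℂ) (volume.restrict (Set.Ioi (0 : ℝ))) _ = K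
    field_simp
  · rw [show ν - μ + 1 / 2 = 1 / 2 - μ + ν by ring]
    exact hc0.trans hb
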